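/- arXiv:2210.04929 — 2 statements merged into one kernel-verified Lean document; each statement's English description precedes it below -/
import Mathlib

section
/- Let A be a finite set of assets and let there be m CFMMs, where CFMM i has reserves x_i ∈ ℝ^A with all coordinates strictly positive and a trading function f_i : ℝ^A_{>0} → ℝ that is differentiable and quasiconcave on the convex set ℝ^A_{>0}. Suppose there exist a valuation vector q ∈ ℝ^A with q(a) > 0 for all a, and scalars λ_i > 0, such that ∇f_i(x_i) = λ_i · q for every i (all CFMMs' spot valuations are proportional to q). Then there is no internal arbitrage: for any trade vectors Δ_i ∈ ℝ^A with x_i + Δ_i ∈ ℝ^A_{>0} and f_i(x_i + Δ_i) ≥ f_i(x_i) for every i, the net proceeds vector −∑_i Δ_i cannot be nonnegative in every coordinate and strictly positive in some coordinate. -/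
open Finset

/-- First-order condition for quasiconcavity: at a point of differentiability, the derivative of a
quasiconcave function is nonnegative in the direction of any point with at least as large a value. -/
theorem QuasiconcaveOn.fderiv_sub_nonneg {E : Type*} [NormedAddCommGroup E] [NormedSpace ℝ E]
    {s : Set E} {f : E → ℝ} {x y : E} (hf : QuasiconcaveOn ℝ s f) (hd : DifferentiableAt ℝ f x)
    (hx : x ∈ s) (hy : y ∈ s) (hxy : f x ≤ f y) : 0 ≤ fderiv ℝ f x (y - x) := by
  have hmin : IsMinOn f (segment ℝ x y) x := fun z hz =>
    ((hf (f x)).segment_subset ⟨hx, le_rfl⟩ ⟨hy, hxy⟩ hz).2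
  exact hmin.localize.hasFDerivWithinAt_nonneg hd.hasFDerivAt.hasFDerivWithinAt
    (sub_mem_posTangentConeAt_of_segment_subset subset_rfl)

/-- If every CFMM's spot valuations (gradient of its trading function at its reserves)
are proportional to a common positive valuation vector `q`, then no collection of
accepted trades against the CFMMs extracts a nonzero nonnegative bundle of assets. -/
theorem no_internal_arbitrage {A : Type*} [Fintype A] [DecidableEq A] {m : ℕ}
    (x : Fin m → A → ℝ) (f : Fin m → (A → ℝ) → ℝ)
    (S : Set (A → ℝ)) (hS : S = {y | ∀ a, 0 < y a})
    (hx : ∀ i, x i ∈ S)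
    (hdiff : ∀ i, DifferentiableOn ℝ (f i) S)
    (hqc : ∀ i, QuasiconcaveOn ℝ S (f i))
    (q : A → ℝ) (hq : ∀ a, 0 < q a)
    (lam : Fin m → ℝ) (hlam : ∀ i, 0 < lam i)
    (hgrad : ∀ i a, fderiv ℝ (f i) (x i) (Pi.single a 1) = lam i * q a)
    (Δ : Fin m → A → ℝ)
    (hfeas : ∀ i, x i + Δ i ∈ S)
    (hacc : ∀ i, f i (x i) ≤ f i (x i + Δ i)) :
    ¬ ((∀ a, 0 ≤ -∑ i, Δ i a) ∧ ∃ a, 0 < -∑ i, Δ i a) := by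
  rintro ⟨hnonneg, b, hb⟩
  have hopen : IsOpen S := by
    simpa [hS, Set.ofPred_forall] using
      isOpen_iInter_of_finite fun a : A => isOpen_lt continuous_const (continuous_apply a)
  have hvalue (i : Fin m) : 0 ≤ ∑ a, q a * Δ i a := by
    have hdir : 0 ≤ fderiv ℝ (f i) (x i) (Δ i) := by
      simpa using (hqc i).fderiv_sub_nonneg ((hdiff i).differentiableAt (hopen.mem_nhds (hx i)))
        (hx i) (hfeas i) (hacc i)
    have hsum : fderiv ℝ (f i) (x i) (Δ i) = lam i * ∑ a, q a * Δ i a := by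
      conv_lhs => rw [pi_eq_sum_univ' (Δ i)]
      simp only [map_sum, map_smul, smul_eq_mul, Finset.mul_sum]
      refine Finset.sum_congr rfl fun a _ => ?_
      rw [hgrad]
      ring
    exact nonneg_of_mul_nonneg_right (hsum ▸ hdir) (hlam i)
  have htotal : 0 ≤ ∑ a, q a * ∑ i, Δ i a := by
    simp only [Finset.mul_sum]
    rw [Finset.sum_comm]
    exact Finset.sum_nonneg fun i _ => hvalue i
  have hproceeds : 0 < ∑ a, q a * -∑ i, Δ i a :=
    Finset.sum_pos' (fun a _ => mul_nonneg (hq a).le (hnonneg a))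
      ⟨b, Finset.mem_univ b, mul_pos (hq b) hb⟩
  simp only [mul_neg, Finset.sum_neg_distrib] at hproceeds
  linarith
end

section
/- Let f, g : ℝ²_{>0} → ℝ be differentiable trading functions with strictly positive partial derivatives everywhere, and let x, y ∈ ℝ²_{>0} be the reserves of two CFMMs. Suppose the spot exchange rate of the first CFMM strictly exceeds that of the second: ∂₁f(x)/∂₂f(x) > ∂₁g(y)/∂₂g(y). Then there exists an arbitrage between the two CFMMs: there exist trade vectors Δ, Δ' ∈ ℝ² with x + Δ ∈ ℝ²_{>0}, y + Δ' ∈ ℝ²_{>0}, f(x + Δ) ≥ f(x), g(y + Δ') ≥ g(y), such that the net proceeds vector −(Δ + Δ') is nonnegative in both coordinates and strictly positive in at least one coordinate. -/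
open Filter Topology in
/-- Moving a short way in a direction of positive derivative increases the function. -/
theorem DifferentiableAt.eventually_lt_add_smul {E : Type*} [NormedAddCommGroup E]
    [NormedSpace ℝ E] {f : E → ℝ} {x v : E} (hf : DifferentiableAt ℝ f x)
    (hv : 0 < fderiv ℝ f x v) : ∀ᶠ t : ℝ in 𝓝[>] 0, f x < f (x + t • v) := by
  have h : HasDerivAt (fun t : ℝ => f (x + t • v)) (fderiv ℝ f x v) 0 :=
    hf.hasFDerivAt.hasLineDerivAt v
  have hslope := (hasDerivAt_iff_tendsto_slope.mp h).mono_left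
    (nhdsWithin_mono 0 fun t (ht : 0 < t) => ht.ne')
  filter_upwards [hslope.eventually_const_lt hv, self_mem_nhdsWithin] with t hs ht
  have ht' : 0 < t := ht
  rw [slope_def_field, sub_zero, div_pos_iff_of_pos_right ht'] at hs
  simpa using hs

open Filter Topology in
theorem IsOpen.eventually_add_smul_mem {E : Type*} [NormedAddCommGroup E] [NormedSpace ℝ E]
    {S : Set E} (hS : IsOpen S) {x : E} (hx : x ∈ S) (v : E) :
    ∀ᶠ t : ℝ in 𝓝[>] 0, x + t • v ∈ S := by
  have hc : Continuous fun t : ℝ => x + t • v := by fun_prop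
  exact nhdsWithin_le_nhds ((hS.preimage hc).mem_nhds (by simpa using hx))

theorem ContinuousLinearMap.apply_fin_two (L : (Fin 2 → ℝ) →L[ℝ] ℝ) (a b : ℝ) :
    L ![a, b] = a * L (Pi.single 0 1) + b * L (Pi.single 1 1) := by
  have h : (![a, b] : Fin 2 → ℝ) = a • Pi.single 0 1 + b • Pi.single 1 1 := by
    ext i
    fin_cases i <;> simp
  rw [h, map_add, map_smul, map_smul, smul_eq_mul, smul_eq_mul]

/-- Two CFMMs whose spot exchange rates differ leave an arbitrage opportunity:
there are accepted trades against both whose net proceeds are a nonnegative,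
nonzero bundle. -/
theorem arbitrage_between_cfmms_with_different_spot_rates
    (f g : (Fin 2 → ℝ) → ℝ)
    (S : Set (Fin 2 → ℝ)) (hS : S = {y | ∀ i, 0 < y i})
    (hdf : ∀ y ∈ S, DifferentiableAt ℝ f y)
    (hdg : ∀ y ∈ S, DifferentiableAt ℝ g y)
    (hpf : ∀ y ∈ S, ∀ i, 0 < fderiv ℝ f y (Pi.single i 1))
    (hpg : ∀ y ∈ S, ∀ i, 0 < fderiv ℝ g y (Pi.single i 1))
    (x y : Fin 2 → ℝ) (hx : x ∈ S) (hy : y ∈ S)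
    (hrate : fderiv ℝ f x (Pi.single 0 1) / fderiv ℝ f x (Pi.single 1 1)
           > fderiv ℝ g y (Pi.single 0 1) / fderiv ℝ g y (Pi.single 1 1)) :
    ∃ Δ Δ' : Fin 2 → ℝ, x + Δ ∈ S ∧ y + Δ' ∈ S ∧
      f (x + Δ) ≥ f x ∧ g (y + Δ') ≥ g y ∧
      (∀ i, 0 ≤ -(Δ i + Δ' i)) ∧ (∃ i, 0 < -(Δ i + Δ' i)) := by
  have hopen : IsOpen S := by
    rw [hS, Set.ofPred_forall]
    exact isOpen_iInter_of_finite fun i => isOpen_lt continuous_const (continuous_apply i)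
  obtain ⟨s, hgs, hsf⟩ := exists_between hrate
  obtain ⟨r, hsr, hrf⟩ := exists_between hsf
  rw [div_lt_iff₀ (hpg y hy 1)] at hgs
  rw [lt_div_iff₀ (hpf x hx 1)] at hrf
  have hf : 0 < fderiv ℝ f x ![1, -r] := by
    rw [ContinuousLinearMap.apply_fin_two]
    linarith
  have hg : 0 < fderiv ℝ g y ![-1, s] := by
    rw [ContinuousLinearMap.apply_fin_two]
    linarith
  obtain ⟨t, hft, hgt, hxt, hyt, ht⟩ :=
    ((hdf x hx).eventually_lt_add_smul hf |>.and <|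
      (hdg y hy).eventually_lt_add_smul hg |>.and <|
      (hopen.eventually_add_smul_mem hx ![1, -r]).and <|
      (hopen.eventually_add_smul_mem hy ![-1, s]).and self_mem_nhdsWithin).exists
  have hgain : 0 < t * (r - s) := mul_pos ht (sub_pos.mpr hsr)
  refine ⟨t • ![1, -r], t • ![-1, s], hxt, hyt, hft.le, hgt.le, fun i => ?_, 1, ?_⟩
  · fin_cases i
    · simp
    · simp
      linarith
  · simp
    linarith
end
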